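/- Let n ≥ 1, 1 ≤ p, q, r ≤ ∞ with 1/p = 1/q + 1/r, and k ≥ 0 an integer. Then there is a constant C such that for all smooth compactly supported u, v : ℝⁿ → ℝ, ‖∂ₓᵏ(uv)‖_{L^p} ≤ C(‖u‖_{L^q} ‖∂ₓᵏ v‖_{L^r} + ‖v‖_{L^q} ‖∂ₓᵏ u‖_{L^r}), where ‖∂ₓᵏ f‖ denotes the sum of L-norms of all k-th order spatial derivatives of f. -/

import Mathlib

open MeasureTheory ENNReal NNReal

/-- crossing lemma -/
lemma crossing (φ : ℝ → ℝ) (hφ : Continuous φ) (t s₁ : ℝ) (hs : 0 ≤ s₁)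
    (h0 : t < φ 0) (h1 : φ s₁ < t / 2) :
    ∃ a b, 0 ≤ a ∧ a ≤ b ∧ b ≤ s₁ ∧ t ≤ φ a ∧ φ b ≤ t / 2 ∧
      ∀ s ∈ Set.Ioo a b, t / 2 ≤ φ s ∧ φ s ≤ t := by
  have hc1 : IsCompact (Set.Icc 0 s₁ ∩ {s | t ≤ φ s}) :=
    isCompact_Icc.inter_right (isClosed_le continuous_const hφ)
  obtain ⟨a, ⟨⟨ha0, ha1⟩, hat⟩, hag⟩ := hc1.exists_isGreatest ⟨0, ⟨le_refl _, hs⟩, h0.le⟩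
  have hc2 : IsCompact (Set.Icc a s₁ ∩ {s | φ s ≤ t / 2}) :=
    isCompact_Icc.inter_right (isClosed_le hφ continuous_const)
  obtain ⟨b, ⟨⟨hb0, hb1⟩, hbt⟩, hbl⟩ := hc2.exists_isLeast ⟨s₁, ⟨ha1, le_refl _⟩, h1.le⟩
  refine ⟨a, b, ha0, hb0, hb1, hat, hbt, fun s hs => ⟨?_, ?_⟩⟩
  · by_contra hlt
    push Not at hlt
    exact absurd (hbl ⟨⟨hs.1.le, hs.2.le.trans hb1⟩, hlt.le⟩) (not_le.2 hs.2)
  · by_contra hlt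
    push Not at hlt
    exact absurd (hag ⟨⟨ha0.trans hs.1.le, hs.2.le.trans hb1⟩, hlt.le⟩) (not_le.2 hs.1)

section level
variable {E : Type*} [NormedAddCommGroup E] [NormedSpace ℝ E] [FiniteDimensional ℝ E]
  [MeasurableSpace E] [BorelSpace E] (μ : Measure E) [μ.IsAddHaarMeasure]

lemma level_subset (e : E) (w g f : E → ℝ) (hg : Continuous g) (hf : Continuous f)
    (hwg : ∀ x (t : ℝ), HasDerivAt (fun s : ℝ => w (x + s • e)) (g (x + t • e)) t)
    (hgf : ∀ x (t : ℝ), HasDerivAt (fun s : ℝ => g (x + s • e)) (f (x + t • e)) t)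
    (t h : ℝ) (ht : 0 < t) (hh : 0 < h) :
    {x | t < |g x|} ⊆ ({x | h * t / 4 ≤ |w (x + h • e)|} ∪ {x | h * t / 4 ≤ |w x|}) ∪
      {x | ENNReal.ofReal (t / 2) ≤ ∫⁻ s in Set.Icc 0 h,
        {y | t / 2 ≤ |g y| ∧ |g y| ≤ t}.indicator (fun y => ‖f y‖ₑ) (x + s • e)} := by
  intro x hx
  simp only [Set.mem_ofPred_eq] at hx
  by_cases hc : ∀ s ∈ Set.Icc 0 h, t / 2 ≤ |g (x + s • e)|
  · left
    obtain ⟨ξ, hξ, hs⟩ := exists_hasDerivAt_eq_slope (fun s : ℝ => w (x + s • e))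
      (fun s => g (x + s • e)) hh
      (fun s _ => (hwg x s).continuousAt.continuousWithinAt) (fun s _ => hwg x s)
    have h1 := hc ξ ⟨hξ.1.le, hξ.2.le⟩
    rw [hs, abs_div, sub_zero, abs_of_pos hh, le_div_iff₀ hh] at h1
    simp only [zero_smul, add_zero] at h1
    have h2 := abs_sub (w (x + h • e)) (w x)
    by_contra hcon
    simp only [Set.mem_union, Set.mem_ofPred_eq, not_or, not_le] at hcon
    nlinarith [hcon.1, hcon.2]
  · right
    push Not at hc
    obtain ⟨s₁, hs1, hs2⟩ := hc
    have hcx : Continuous (fun s : ℝ => x + s • e) := by fun_prop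
    obtain ⟨a, b, ha, hab, hb, hfa, hfb, hI⟩ := crossing (fun s => |g (x + s • e)|)
      (by fun_prop) t s₁ hs1.1 (by simpa using hx) hs2
    have hint : IntervalIntegrable (fun s => f (x + s • e)) volume a b :=
      (hf.comp hcx).intervalIntegrable _ _
    have hftc := intervalIntegral.integral_eq_sub_of_hasDerivAt
      (fun s _ => hgf x s) hint
    simp only [Set.mem_ofPred_eq]
    calc ENNReal.ofReal (t / 2) ≤ ‖∫ s in a..b, f (x + s • e)‖ₑ := by
          rw [hftc, ← ofReal_norm, Real.norm_eq_abs]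
          apply ENNReal.ofReal_le_ofReal
          have := abs_sub_abs_le_abs_sub (g (x + a • e)) (g (x + b • e))
          rw [abs_sub_comm]
          linarith
      _ ≤ ∫⁻ s in Set.Ioo a b, ‖f (x + s • e)‖ₑ := by
          rw [intervalIntegral.integral_of_le hab, integral_Ioc_eq_integral_Ioo]
          exact enorm_integral_le_lintegral_enorm _
      _ = ∫⁻ s in Set.Ioo a b, {y | t / 2 ≤ |g y| ∧ |g y| ≤ t}.indicator
            (fun y => ‖f y‖ₑ) (x + s • e) := by
          apply setLIntegral_congr_fun measurableSet_Ioo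
          intro s hs
          simp only
          rw [Set.indicator_of_mem]
          exact hI s hs
      _ ≤ _ := lintegral_mono_set (fun s (hs : s ∈ Set.Ioo a b) => (⟨ha.trans hs.1.le, hs.2.le.trans (hb.trans hs1.2)⟩ : s ∈ Set.Icc 0 h))

lemma level_meas (e : E) (w g f : E → ℝ) (hg : Continuous g) (hf : Continuous f)
    (hwg : ∀ x (t : ℝ), HasDerivAt (fun s : ℝ => w (x + s • e)) (g (x + t • e)) t)
    (hgf : ∀ x (t : ℝ), HasDerivAt (fun s : ℝ => g (x + s • e)) (f (x + t • e)) t)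
    (t h : ℝ) (ht : 0 < t) (hh : 0 < h) :
    μ {x | t < |g x|} ≤ 2 * μ {x | h * t / 4 ≤ |w x|} +
      ENNReal.ofReal (2 * h / t) *
        ∫⁻ y, {y | t / 2 ≤ |g y| ∧ |g y| ≤ t}.indicator (fun y => ‖f y‖ₑ) y ∂μ := by
  set F : E → ℝ≥0∞ := {y | t / 2 ≤ |g y| ∧ |g y| ≤ t}.indicator (fun y => ‖f y‖ₑ) with hF
  have hmF : Measurable F := by
    apply Measurable.indicator hf.enorm.measurable
    exact ((isClosed_le continuous_const hg.abs).inter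
      (isClosed_le hg.abs continuous_const)).measurableSet
  have hmF2 : Measurable (Function.uncurry fun (x : E) (s : ℝ) => F (x + s • e)) :=
    hmF.comp (by fun_prop : Continuous fun z : E × ℝ => z.1 + z.2 • e).measurable
  refine (measure_mono (level_subset e w g f hg hf hwg hgf t h ht hh)).trans ?_
  refine (measure_union_le _ _).trans (add_le_add ((measure_union_le _ _).trans ?_) ?_)
  · rw [two_mul]
    refine add_le_add ?_ le_rfl
    exact (measure_preimage_add_right μ (h • e) {x | h * t / 4 ≤ |w x|}).le
  · have hM := mul_meas_ge_le_lintegral₀ (μ := μ)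
      (f := fun x => ∫⁻ s in Set.Icc 0 h, F (x + s • e))
      (hmF2.lintegral_prod_right').aemeasurable (ENNReal.ofReal (t / 2))
    rw [lintegral_lintegral_swap hmF2.aemeasurable] at hM
    simp only [lintegral_add_right_eq_self, lintegral_const, Measure.restrict_apply_univ,
      Real.volume_Icc, sub_zero] at hM
    have h2 : ENNReal.ofReal (2 * h / t) = (ENNReal.ofReal (t / 2))⁻¹ * ENNReal.ofReal h := by
      rw [← ENNReal.ofReal_inv_of_pos (by positivity), ← ENNReal.ofReal_mul (by positivity)]
      congr 1
      field_simp
    rw [h2, mul_assoc, ← ENNReal.div_eq_inv_mul, ENNReal.le_div_iff_mul_le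
      (Or.inl (by simpa using ht)) (Or.inl ENNReal.ofReal_ne_top)]
    rw [mul_comm, mul_comm (ENNReal.ofReal h)]
    exact hM

lemma inner_bound (c σ G : ℝ) (hc : 0 < c) (hG : 0 ≤ G) :
    ∫⁻ t in Set.Ioi (0:ℝ), {t : ℝ | t / 2 ≤ G ∧ G ≤ t}.indicator
      (fun t => ENNReal.ofReal (c * t ^ σ)) t ≤
      ENNReal.ofReal (c * 2 ^ |σ| * G ^ (σ + 1)) := by
  have hset : {t : ℝ | t / 2 ≤ G ∧ G ≤ t} = Set.Icc G (2 * G) := by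
    ext t
    simp only [Set.mem_ofPred_eq, Set.mem_Icc]
    constructor <;> rintro ⟨h1, h2⟩ <;> constructor <;> linarith
  rw [hset, lintegral_indicator measurableSet_Icc, Measure.restrict_restrict measurableSet_Icc]
  rcases hG.eq_or_lt with rfl | hG
  · have : Set.Icc (0:ℝ) (2 * 0) ∩ Set.Ioi 0 = ∅ := by
      ext t
      simp only [Set.mem_inter_iff, Set.mem_Icc, Set.mem_Ioi, Set.mem_empty_iff_false, iff_false]
      rintro ⟨⟨h1, h2⟩, h3⟩
      linarith
    rw [this]
    simp
  · have hb : ∀ t ∈ Set.Icc G (2 * G) ∩ Set.Ioi 0, ENNReal.ofReal (c * t ^ σ) ≤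
        ENNReal.ofReal (c * (2 ^ |σ| * G ^ σ)) := by
      rintro t ⟨⟨h1, h2⟩, h3⟩
      have h3 : 0 < t := h3
      apply ENNReal.ofReal_le_ofReal
      gcongr
      have ht : t = (t / G) * G := by field_simp
      rw [ht, Real.mul_rpow (div_nonneg h3.le hG.le) hG.le]
      gcongr
      have h1' : 1 ≤ t / G := by rwa [le_div_iff₀ hG, one_mul]
      calc (t / G) ^ σ ≤ (t / G) ^ |σ| := Real.rpow_le_rpow_of_exponent_le h1' (le_abs_self _)
        _ ≤ 2 ^ |σ| := by
          apply Real.rpow_le_rpow (zero_le_one.trans h1') _ (abs_nonneg _)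
          rwa [div_le_iff₀ hG]
    refine (setLIntegral_mono' (measurableSet_Icc.inter measurableSet_Ioi) hb).trans ?_
    rw [lintegral_const, Measure.restrict_apply_univ]
    refine (mul_le_mul_right (measure_mono Set.inter_subset_left) _).trans ?_
    rw [Real.volume_Icc, ← ENNReal.ofReal_mul (by positivity)]
    apply ENNReal.ofReal_le_ofReal
    rw [Real.rpow_add_one hG.ne']
    apply le_of_eq
    ring

lemma layer (e : E) (w g f : E → ℝ) (hg : Continuous g) (hf : Continuous f)
    (hwg : ∀ x (t : ℝ), HasDerivAt (fun s : ℝ => w (x + s • e)) (g (x + t • e)) t)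
    (hgf : ∀ x (t : ℝ), HasDerivAt (fun s : ℝ => g (x + s • e)) (f (x + t • e)) t)
    (p a c : ℝ) (hp : 0 < p) (hc : 0 < c) :
    ∫⁻ x, ENNReal.ofReal (|g x| ^ p) ∂μ ≤
      2 * (ENNReal.ofReal p * ∫⁻ t in Set.Ioi (0:ℝ), μ {x | c * t ^ a / 4 ≤ |w x|} *
        ENNReal.ofReal (t ^ (p - 1))) +
      ENNReal.ofReal (c * (2 * p * 2 ^ |p + a - 3|)) *
        ∫⁻ x, ‖f x‖ₑ * ENNReal.ofReal (|g x| ^ (p + a - 2)) ∂μ := by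
  rw [lintegral_rpow_eq_lintegral_meas_lt_mul μ (ae_of_all _ fun x => abs_nonneg (g x))
    hg.abs.measurable.aemeasurable hp]
  set H : ℝ → E → ℝ≥0∞ := fun t x => {z : ℝ × E | z.1 / 2 ≤ |g z.2| ∧ |g z.2| ≤ z.1}.indicator
    (fun z => ENNReal.ofReal (2 * c * z.1 ^ (p + a - 3)) * ‖f z.2‖ₑ) (t, x) with hH
  have hHm : Measurable (Function.uncurry H) := by
    have h1 : Measurable (fun z : ℝ × E =>
        ENNReal.ofReal (2 * c * z.1 ^ (p + a - 3)) * ‖f z.2‖ₑ) :=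
      (((measurable_fst.pow_const _).const_mul _).ennreal_ofReal).mul
        (hf.enorm.measurable.comp measurable_snd)
    have h2 : MeasurableSet {z : ℝ × E | z.1 / 2 ≤ |g z.2| ∧ |g z.2| ≤ z.1} := by
      have c1 : Continuous fun z : ℝ × E => z.1 / 2 := by fun_prop
      have c2 : Continuous fun z : ℝ × E => |g z.2| := by fun_prop
      exact ((isClosed_le c1 c2).inter (isClosed_le c2 continuous_fst)).measurableSet
    exact h1.indicator h2
  have hHm2 : Measurable fun t => ∫⁻ x, H t x ∂μ := hHm.lintegral_prod_right'
  have hmain : ∀ t ∈ Set.Ioi (0:ℝ), μ {x | t < |g x|} * ENNReal.ofReal (t ^ (p - 1)) ≤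
      2 * (μ {x | c * t ^ a / 4 ≤ |w x|} * ENNReal.ofReal (t ^ (p - 1))) +
      ∫⁻ x, H t x ∂μ := by
    intro t ht
    have ht : 0 < t := ht
    refine (mul_le_mul_left (level_meas μ e w g f hg hf hwg hgf t (c * t ^ (a - 1)) ht
      (by positivity)) _).trans ?_
    rw [add_mul, mul_assoc]
    refine add_le_add (le_of_eq ?_) (le_of_eq ?_)
    · congr 5
      ext x
      rw [mul_assoc, ← Real.rpow_add_one ht.ne']
      simp
    · rw [mul_right_comm, ← ENNReal.ofReal_mul (by positivity), ← lintegral_const_mul']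
      · apply lintegral_congr
        intro x
        simp only [hH, Set.indicator_apply, Set.mem_ofPred_eq]
        split_ifs
        · congr 2
          rw [show p + a - 3 = (a - 1) + (p - 1) - 1 by ring, Real.rpow_sub_one ht.ne' (_ + _),
            Real.rpow_add ht]
          ring
        · simp
      · exact ENNReal.ofReal_ne_top
  refine (mul_le_mul_right (setLIntegral_mono' measurableSet_Ioi hmain) _).trans ?_
  rw [lintegral_add_right _ hHm2, lintegral_const_mul' _ _ (by simp), mul_add]
  refine add_le_add (le_of_eq (by ring)) ?_
  rw [lintegral_lintegral_swap hHm.aemeasurable]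
  rw [← lintegral_const_mul' _ _ ENNReal.ofReal_ne_top, ← lintegral_const_mul' _ _ ENNReal.ofReal_ne_top]
  apply lintegral_mono
  intro x
  have h1 : ∫⁻ t in Set.Ioi (0:ℝ), H t x = (∫⁻ t in Set.Ioi (0:ℝ),
      {t : ℝ | t / 2 ≤ |g x| ∧ |g x| ≤ t}.indicator
      (fun t => ENNReal.ofReal (2 * c * t ^ (p + a - 3))) t) * ‖f x‖ₑ := by
    rw [← lintegral_mul_const' _ _ enorm_ne_top]
    apply lintegral_congr
    intro t
    simp only [hH, Set.indicator_apply, Set.mem_ofPred_eq]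
    split_ifs <;> simp
  simp only [h1]
  refine (mul_le_mul_right (mul_le_mul_left (inner_bound _ _ _ (by positivity) (abs_nonneg _)) _)
    _).trans (le_of_eq ?_)
  rw [show p + a - 3 + 1 = p + a - 2 by ring, mul_comm ‖f x‖ₑ, ← mul_assoc, ← mul_assoc,
    ← ENNReal.ofReal_mul (by positivity), ← ENNReal.ofReal_mul (by positivity)]
  congr 2
  ring

lemma lint_eq (w : E → ℝ) (q : ℝ≥0∞) (hq0 : q ≠ 0) (hq : q ≠ ∞) (hw : MemLp w q μ) :
    ∫⁻ x, ENNReal.ofReal (|w x| ^ q.toReal) ∂μ =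
      ENNReal.ofReal ((eLpNorm w q μ).toReal ^ q.toReal) := by
  have hqp : 0 < q.toReal := ENNReal.toReal_pos hq0 hq
  rw [← ENNReal.ofReal_rpow_of_nonneg ENNReal.toReal_nonneg hqp.le,
    ENNReal.ofReal_toReal hw.eLpNorm_ne_top, eLpNorm_eq_lintegral_rpow_enorm_toReal hq0 hq,
    ← ENNReal.rpow_mul, one_div, inv_mul_cancel₀ hqp.ne', ENNReal.rpow_one]
  apply lintegral_congr
  intro x
  rw [← ENNReal.ofReal_rpow_of_nonneg (abs_nonneg _) hqp.le, ← Real.norm_eq_abs, ofReal_norm]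

lemma T_bound (w : E → ℝ) (hw : Continuous w) (p : ℝ) (hp : 0 < p) (q : ℝ≥0∞) (hq : 1 ≤ q)
    (hwq : MemLp w q μ) (c X : ℝ) (hc : 0 < c) (hX : 0 < X)
    (h : ENNReal.ofReal (X / 2) ≤ 2 * (ENNReal.ofReal p * ∫⁻ t in Set.Ioi (0:ℝ),
      μ {x | c * t ^ (p * (q⁻¹).toReal) / 4 ≤ |w x|} * ENNReal.ofReal (t ^ (p - 1)))) :
    X ^ (q⁻¹).toReal * c ≤ 16 * (eLpNorm w q μ).toReal := by
  rcases eq_or_ne q ∞ with rfl | hqt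
  · simp only [ENNReal.inv_top, ENNReal.toReal_zero, Real.rpow_zero, one_mul, mul_zero, mul_one]
      at h ⊢
    by_contra hcon
    push Not at hcon
    have hz : μ {x | c / 4 ≤ |w x|} = 0 := by
      have hA := ae_le_eLpNormEssSup (f := w) (μ := μ)
      rw [← eLpNorm_exponent_top] at hA
      rw [← compl_compl {x | c / 4 ≤ |w x|}]
      change {x | c / 4 ≤ |w x|}ᶜ ∈ ae μ
      filter_upwards [hA] with x hx
      simp only [Set.mem_compl_iff, Set.mem_ofPred_eq, not_le]
      have := ENNReal.toReal_mono hwq.eLpNorm_ne_top hx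
      simp only [toReal_enorm, Real.norm_eq_abs] at this
      have := abs_nonneg (w x)
      linarith
    simp only [hz, zero_mul, lintegral_zero, mul_zero, nonpos_iff_eq_zero,
      ENNReal.ofReal_eq_zero] at h
    linarith
  · have hq0 : q ≠ 0 := (zero_lt_one.trans_le hq).ne'
    set Q := q.toReal with hQ
    have hQ1 : 1 ≤ Q := by
      rw [hQ, ← ENNReal.toReal_one]
      exact ENNReal.toReal_mono hqt hq
    have hQ0 : 0 < Q := by linarith
    rw [ENNReal.toReal_inv, ← hQ] at h ⊢
    set A := (eLpNorm w q μ).toReal with hA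
    have hA0 : 0 ≤ A := ENNReal.toReal_nonneg
    have hT : (ENNReal.ofReal p * ∫⁻ t in Set.Ioi (0:ℝ),
      μ {x | c * t ^ (p * Q⁻¹) / 4 ≤ |w x|} * ENNReal.ofReal (t ^ (p - 1))) =
      ENNReal.ofReal ((4 / c) ^ Q * A ^ Q) := by
      have e1 : ∀ t ∈ Set.Ioi (0:ℝ), μ {x | c * t ^ (p * Q⁻¹) / 4 ≤ |w x|} *
          ENNReal.ofReal (t ^ (p - 1)) =
          μ {x | t ≤ (4 / c * |w x|) ^ (Q / p)} * ENNReal.ofReal (t ^ (p - 1)) := by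
        intro t ht
        have ht : 0 < t := ht
        congr 3
        ext x
        rw [← Real.rpow_inv_le_iff_of_pos ht.le (by positivity) (by positivity),
          inv_div, div_eq_mul_inv p Q]
        constructor
        · intro h
          rw [div_mul_eq_mul_div, le_div_iff₀ hc]
          linarith
        · intro h
          rw [div_mul_eq_mul_div, le_div_iff₀ hc] at h
          linarith
      rw [setLIntegral_congr_fun measurableSet_Ioi e1,
        ← lintegral_rpow_eq_lintegral_meas_le_mul μ (f := fun x => (4 / c * |w x|) ^ (Q / p))
          (ae_of_all _ fun x => by positivity)
          ((hw.abs.measurable.const_mul _).pow_const _).aemeasurable hp]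
      rw [ENNReal.ofReal_mul (by positivity), ← lint_eq μ w q hq0 hqt hwq,
        ← lintegral_const_mul' _ _ ENNReal.ofReal_ne_top]
      apply lintegral_congr
      intro x
      rw [← ENNReal.ofReal_mul (by positivity), ← Real.rpow_mul (by positivity),
        div_mul_cancel₀ _ hp.ne', Real.mul_rpow (by positivity) (by positivity)]
    rw [hT, ← ENNReal.ofReal_ofNat 2, ← ENNReal.ofReal_mul (by positivity),
      ENNReal.ofReal_le_ofReal_iff (by positivity)] at h
    have h4 : (4:ℝ) ≤ 4 ^ Q := by
      conv_lhs => rw [← Real.rpow_one 4]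
      exact Real.rpow_le_rpow_of_exponent_le (by norm_num) hQ1
    have h5 : X ≤ (16 * A / c) ^ Q := by
      calc X ≤ 4 * ((4 / c) ^ Q * A ^ Q) := by linarith
        _ ≤ 4 ^ Q * ((4 / c) ^ Q * A ^ Q) := by gcongr
        _ = _ := by
          rw [← Real.mul_rpow (by positivity) (by positivity),
            ← Real.mul_rpow (by positivity) (by positivity)]
          congr 1
          ring
    rw [← Real.rpow_inv_le_iff_of_pos hX.le (by positivity) hQ0] at h5
    rwa [le_div_iff₀ hc] at h5

lemma holder_bound (g f : E → ℝ) (hg : Continuous g) (hf : Continuous f) (p r : ℝ≥0∞)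
    (hp0 : p ≠ 0) (hp : p ≠ ∞) (hr : 1 ≤ r) :
    ∫⁻ x, ‖f x‖ₑ * ENNReal.ofReal (|g x| ^ (p.toReal * (1 - (r⁻¹).toReal))) ∂μ ≤
      eLpNorm f r μ * eLpNorm g p μ ^ (p.toReal * (1 - (r⁻¹).toReal)) := by
  rcases hr.eq_or_lt with rfl | hr
  · simp [eLpNorm_one_eq_lintegral_enorm]
  · have hp' : 0 < p.toReal := ENNReal.toReal_pos hp0 hp
    have hri : r⁻¹ < 1 := by rwa [ENNReal.inv_lt_one]
    have hβ : 0 < 1 - (r⁻¹).toReal := by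
      rw [sub_pos, ← ENNReal.toReal_one]
      exact (ENNReal.toReal_lt_toReal (hri.trans ENNReal.one_lt_top).ne ENNReal.one_ne_top).2 hri
    set s := p.toReal * (1 - (r⁻¹).toReal) with hs
    have hs0 : 0 < s := by positivity
    have : HolderTriple r (1 - r⁻¹)⁻¹ 1 := ⟨by
      rw [inv_inv, inv_one, add_tsub_cancel_of_le hri.le]⟩
    have hH := eLpNorm_smul_le_mul_eLpNorm (p := r) (q := (1 - r⁻¹)⁻¹) (r := 1) (μ := μ)
      (f := fun x => ‖g x‖ ^ s) (φ := f)
      ((hg.norm.rpow_const (fun x => Or.inr hs0.le)).aestronglyMeasurable)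
      hf.aestronglyMeasurable
    rw [eLpNorm_norm_rpow _ hs0, eLpNorm_one_eq_lintegral_enorm] at hH
    have he : (1 - r⁻¹)⁻¹ * ENNReal.ofReal s = p := by
      have h1 : (1 - r⁻¹) = ENNReal.ofReal (1 - (r⁻¹).toReal) := by
        rw [ENNReal.ofReal_sub _ ENNReal.toReal_nonneg, ENNReal.ofReal_one,
          ENNReal.ofReal_toReal (hri.trans ENNReal.one_lt_top).ne]
      rw [h1, ← ENNReal.ofReal_inv_of_pos hβ, ← ENNReal.ofReal_mul (by positivity), hs]
      rw [show (1 - (r⁻¹).toReal)⁻¹ * (p.toReal * (1 - (r⁻¹).toReal)) = p.toReal by field_simp]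
      exact ENNReal.ofReal_toReal hp
    rw [he] at hH
    refine le_trans (le_of_eq ?_) hH
    apply lintegral_congr
    intro x
    simp only [Pi.smul_apply', smul_eq_mul, enorm_mul]
    congr 1
    rw [Real.enorm_of_nonneg (by positivity), Real.norm_eq_abs]

lemma scalar_fin (p q r : ℝ≥0∞) (hp0 : p ≠ 0) (hp : p ≠ ∞) (hq : 1 ≤ q) (hr : 1 ≤ r)
    (hpqr : p.toReal * ((q⁻¹).toReal + (r⁻¹).toReal) = 2) :
    ∃ C : ℝ, 0 ≤ C ∧ ∀ (e : E) (w g f : E → ℝ), Continuous w → Continuous g → Continuous f →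
    (∀ x (t : ℝ), HasDerivAt (fun s : ℝ => w (x + s • e)) (g (x + t • e)) t) →
    (∀ x (t : ℝ), HasDerivAt (fun s : ℝ => g (x + s • e)) (f (x + t • e)) t) →
    MemLp w q μ → MemLp g p μ → MemLp f r μ →
    (eLpNorm g p μ).toReal ^ 2 ≤ C * ((eLpNorm w q μ).toReal * (eLpNorm f r μ).toReal) := by
  set P := p.toReal with hP
  have hP0 : 0 < P := ENNReal.toReal_pos hp0 hp
  set α := (q⁻¹).toReal with hα
  set β := (r⁻¹).toReal with hβ
  set K := 2 * P * 2 ^ |P + P * α - 3| with hK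
  have hK0 : 0 < K := by positivity
  refine ⟨32 * K, by positivity, ?_⟩
  intro e w g f hw hg hf hwg hgf hwq hgp hfr
  set A := (eLpNorm w q μ).toReal with hA
  set G := (eLpNorm g p μ).toReal with hG
  set B := (eLpNorm f r μ).toReal with hB
  have hA0 : 0 ≤ A := ENNReal.toReal_nonneg
  have hB0 : 0 ≤ B := ENNReal.toReal_nonneg
  have hG0 : 0 ≤ G := ENNReal.toReal_nonneg
  rcases hG0.eq_or_lt with hz | hG0
  · rw [← hz, zero_pow two_ne_zero]; positivity
  suffices hs : ∀ ε > 0, G ^ 2 ≤ 32 * K * (A * B) + ε * (32 * K * A) by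
    by_contra hcon
    push Not at hcon
    have hd : 0 < G ^ 2 - 32 * K * (A * B) := by linarith
    have h1 := hs ((G ^ 2 - 32 * K * (A * B)) / (2 * (32 * K * A + 1))) (by positivity)
    have h2 : (G ^ 2 - 32 * K * (A * B)) / (2 * (32 * K * A + 1)) * (32 * K * A) <
        G ^ 2 - 32 * K * (A * B) := by
      rw [div_mul_eq_mul_div, div_lt_iff₀ (by positivity)]
      have : 0 ≤ 32 * K * A := by positivity
      nlinarith
    linarith
  intro ε hε
  set c := G ^ (P * β) / (2 * K * (B + ε)) with hc
  have hc0 : 0 < c := by positivity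
  have hL := layer μ e w g f hg hf hwg hgf P (P * α) c hP0 hc0
  rw [lint_eq μ g p hp0 hp hgp, ← hP, ← hG, ← hK,
    show P + P * α - 2 = P * (1 - β) by linarith] at hL
  have hX : 0 < G ^ P := by positivity
  have h2 : ENNReal.ofReal (c * K) * ∫⁻ x, ‖f x‖ₑ * ENNReal.ofReal (|g x| ^ (P * (1 - β))) ∂μ ≤
      ENNReal.ofReal (G ^ P / 2) := by
    refine (mul_le_mul_right (holder_bound μ g f hg hf p r hp0 hp hr) _).trans ?_
    rw [← ENNReal.ofReal_toReal hfr.eLpNorm_ne_top, ← ENNReal.ofReal_toReal hgp.eLpNorm_ne_top,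
      ← hB, ← hG, ← hP, ← hβ, ENNReal.ofReal_rpow_of_pos hG0,
      ← ENNReal.ofReal_mul (by positivity), ← ENNReal.ofReal_mul (by positivity)]
    apply ENNReal.ofReal_le_ofReal
    have h3 : G ^ P = G ^ (P * β) * G ^ (P * (1 - β)) := by
      rw [← Real.rpow_add hG0]; congr 1; ring
    rw [h3, hc]
    have h4 : G ^ (P * β) / (2 * K * (B + ε)) * K * (B * G ^ (P * (1 - β))) =
      (G ^ (P * β) * G ^ (P * (1 - β)) / 2) * (B / (B + ε)) := by
      field_simp
    rw [h4]
    apply mul_le_of_le_one_right (by positivity)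
    rw [div_le_one (by positivity)]
    linarith
  have h3 := hL.trans (add_le_add le_rfl h2)
  have h4 : ENNReal.ofReal (G ^ P) = ENNReal.ofReal (G ^ P / 2) + ENNReal.ofReal (G ^ P / 2) := by
    rw [← ENNReal.ofReal_add (by positivity) (by positivity)]
    congr 1; ring
  rw [h4] at h3
  have h5 := T_bound μ w hw P hP0 q hq hwq c (G ^ P) hc0 hX
    ((ENNReal.add_le_add_iff_right ENNReal.ofReal_ne_top).1 h3)
  rw [← hA, ← hα, ← Real.rpow_mul hG0.le, hc, mul_div_assoc', ← Real.rpow_add hG0,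
    ← mul_add, hpqr, div_le_iff₀ (by positivity), Real.rpow_two] at h5
  linarith

lemma scalar_top (e : E) (w g f : E → ℝ) (hf : Continuous f) (hw : Continuous w)
    (hg : Continuous g)
    (hwg : ∀ x (t : ℝ), HasDerivAt (fun s : ℝ => w (x + s • e)) (g (x + t • e)) t)
    (hgf : ∀ x (t : ℝ), HasDerivAt (fun s : ℝ => g (x + s • e)) (f (x + t • e)) t)
    (hwq : MemLp w ∞ μ) (hfr : MemLp f ∞ μ) :
    (eLpNorm g ∞ μ).toReal ^ 2 ≤ 8 * ((eLpNorm w ∞ μ).toReal * (eLpNorm f ∞ μ).toReal) := by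
  have key : ∀ φ : E → ℝ, Continuous φ → MemLp φ ∞ μ → ∀ x, |φ x| ≤ (eLpNorm φ ∞ μ).toReal := by
    intro φ hφ hm x
    have hA := ae_le_eLpNormEssSup (f := φ) (μ := μ)
    rw [← eLpNorm_exponent_top] at hA
    have hA' : ∀ᵐ x ∂μ, |φ x| ≤ (eLpNorm φ ∞ μ).toReal := by
      filter_upwards [hA] with x hx
      simpa using ENNReal.toReal_mono hm.eLpNorm_ne_top hx
    have hcl : IsClosed {x | |φ x| ≤ (eLpNorm φ ∞ μ).toReal} :=
      isClosed_le hφ.abs continuous_const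
    have := (Measure.dense_of_ae hA').closure_eq
    rw [hcl.closure_eq] at this
    exact (Set.eq_univ_iff_forall.1 this x)
  set A := (eLpNorm w ∞ μ).toReal with hA
  set B := (eLpNorm f ∞ μ).toReal with hB
  have hA0 : 0 ≤ A := ENNReal.toReal_nonneg
  have hB0 : 0 ≤ B := ENNReal.toReal_nonneg
  have hpt : ∀ x, ∀ h > 0, h * |g x| ≤ 2 * A + B * h ^ 2 := by
    intro x h hh
    obtain ⟨ξ, hξ, hs⟩ := exists_hasDerivAt_eq_slope (fun s : ℝ => w (x + s • e))
      (fun s => g (x + s • e)) hh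
      (fun s _ => (hwg x s).continuousAt.continuousWithinAt) (fun s _ => hwg x s)
    obtain ⟨η, hη, hs'⟩ := exists_hasDerivAt_eq_slope (fun s : ℝ => g (x + s • e))
      (fun s => f (x + s • e)) hξ.1
      (fun s _ => (hgf x s).continuousAt.continuousWithinAt) (fun s _ => hgf x s)
    simp only [zero_smul, add_zero, sub_zero] at hs hs'
    have h1 := key w hw hwq (x + h • e)
    have h2 := key w hw hwq x
    have h3 := key f hf hfr (x + η • e)
    rw [eq_div_iff hh.ne'] at hs
    rw [eq_div_iff hξ.1.ne'] at hs'
    have h4 : g x * h = (w (x + h • e) - w x) - f (x + η • e) * (ξ * h) := by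
      rw [← hs, ← mul_assoc, hs']; ring
    have h5 : |g x * h| ≤ |w (x + h • e)| + |w x| + |f (x + η • e)| * (ξ * h) := by
      rw [h4]
      refine (abs_sub _ _).trans (add_le_add (abs_sub _ _) ?_)
      rw [abs_mul, abs_of_pos (mul_pos hξ.1 hh)]
    rw [abs_mul, abs_of_pos hh] at h5
    have h6 : |f (x + η • e)| * (ξ * h) ≤ B * (h * h) := by
      have := hξ.1; have := hξ.2.le
      gcongr
    nlinarith
  have hpt2 : ∀ x, |g x| ^ 2 ≤ 8 * (A * B) := by
    intro x
    rcases (abs_nonneg (g x)).eq_or_lt with hz | hG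
    · rw [← hz, zero_pow two_ne_zero]; positivity
    set G := |g x|
    rcases hB0.eq_or_lt with hz | hB1
    · have := hpt x ((2 * A + 1) / G) (by positivity)
      rw [← hz, div_mul_cancel₀ _ hG.ne'] at this
      linarith
    · have := hpt x (G / (2 * B)) (by positivity)
      have e1 : G / (2 * B) * G = G ^ 2 / (2 * B) := by ring
      have e2 : B * (G / (2 * B)) ^ 2 = G ^ 2 / (4 * B) := by field_simp; ring
      have e3 : G ^ 2 / (2 * B) = G ^ 2 / (4 * B) + G ^ 2 / (4 * B) := by field_simp; ring
      have e4 : G ^ 2 / (4 * B) ≤ 2 * A := by linarith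
      rw [div_le_iff₀ (by positivity)] at e4
      linarith
  have h1 : eLpNorm g ∞ μ ≤ ENNReal.ofReal (√(8 * (A * B))) := by
    rw [eLpNorm_exponent_top]
    apply eLpNormEssSup_le_of_ae_bound
    exact ae_of_all _ fun x => Real.le_sqrt_of_sq_le (hpt2 x)
  calc (eLpNorm g ∞ μ).toReal ^ 2 ≤ (√(8 * (A * B))) ^ 2 := by
        gcongr
        exact ENNReal.toReal_le_of_le_ofReal (by positivity) h1
    _ = _ := Real.sq_sqrt (by positivity)

lemma scalar_gn (p q r : ℝ≥0∞) (hp0 : p ≠ 0) (hq : 1 ≤ q) (hr : 1 ≤ r)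
    (hpqr : 2 * (p⁻¹).toReal = (q⁻¹).toReal + (r⁻¹).toReal) :
    ∃ C : ℝ, 0 ≤ C ∧ ∀ (e : E) (w g f : E → ℝ), Continuous w → Continuous g → Continuous f →
    (∀ x (t : ℝ), HasDerivAt (fun s : ℝ => w (x + s • e)) (g (x + t • e)) t) →
    (∀ x (t : ℝ), HasDerivAt (fun s : ℝ => g (x + s • e)) (f (x + t • e)) t) →
    MemLp w q μ → MemLp g p μ → MemLp f r μ →
    (eLpNorm g p μ).toReal ^ 2 ≤ C * ((eLpNorm w q μ).toReal * (eLpNorm f r μ).toReal) := by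
  rcases eq_or_ne p ∞ with rfl | hp
  · simp only [ENNReal.inv_top, ENNReal.toReal_zero, mul_zero] at hpqr
    have h1 : 0 ≤ (q⁻¹).toReal := ENNReal.toReal_nonneg
    have h2 : 0 ≤ (r⁻¹).toReal := ENNReal.toReal_nonneg
    have aux : ∀ s : ℝ≥0∞, 1 ≤ s → (s⁻¹).toReal = 0 → s = ∞ := by
      intro s hs h
      rw [ENNReal.toReal_eq_zero_iff] at h
      rcases h with h | h
      · simpa using h
      · rw [ENNReal.inv_eq_top] at h
        simp [h] at hs
    obtain rfl := aux q hq (by linarith)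
    obtain rfl := aux r hr (by linarith)
    exact ⟨8, by norm_num, fun e w g f hw hg hf hwg hgf hwq _ hfr =>
      scalar_top μ e w g f hf hw hg hwg hgf hwq hfr⟩
  · refine scalar_fin μ p q r hp0 hp hq hr ?_
    rw [← hpqr, ENNReal.toReal_inv]
    have := ENNReal.toReal_pos hp0 hp
    field_simp
end level

lemma max_endpoint (d : ℕ → ℝ) (hd : ∀ j, 0 ≤ d j) (k : ℕ)
    (h : ∀ j, j + 2 ≤ k → d (j + 1) ^ 2 ≤ d j * d (j + 2)) (j : ℕ) (hj : j ≤ k) :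
    d j ≤ d 0 + d k := by
  classical
  have hex : ∃ m, m ≤ k ∧ ∀ i ≤ k, d i ≤ d m := by
    obtain ⟨m, hm, hmax⟩ := Finset.exists_max_image (Finset.range (k + 1)) d ⟨0, by simp⟩
    exact ⟨m, by simpa [Nat.lt_succ_iff] using hm, fun i hi => hmax i (by simpa [Nat.lt_succ_iff] using hi)⟩
  obtain ⟨hm1, hm2⟩ := Nat.find_spec hex
  have hmin : ∀ m' < Nat.find hex, ¬ (m' ≤ k ∧ ∀ i ≤ k, d i ≤ d m') := fun m' hm' => Nat.find_min hex hm'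
  generalize Nat.find hex = m at hm1 hm2 hmin
  have h0 := hd 0
  have hk := hd k
  refine (hm2 j hj).trans ?_
  rcases Nat.eq_zero_or_pos m with rfl | hpos
  · linarith
  rcases hm1.eq_or_lt with rfl | hlt
  · linarith
  obtain ⟨i, rfl⟩ : ∃ i, m = i + 1 := ⟨m - 1, by omega⟩
  have h1 := h i (by omega)
  have h2 := hm2 (i + 2) (by omega)
  rcases (hd (i + 1)).eq_or_lt with hz | hp
  · linarith
  exfalso
  apply hmin i (by omega)
  refine ⟨by omega, fun l hl => (hm2 l hl).trans ?_⟩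
  have h3 : d (i + 1) * d (i + 1) ≤ d i * d (i + 1) := by
    nlinarith [hd i]
  exact le_of_mul_le_mul_right h3 hp

lemma chain_bound (c : ℕ → ℝ) (hc : ∀ j, 0 ≤ c j) (k : ℕ) (K : ℝ) (hK : 1 ≤ K)
    (h : ∀ j, j + 2 ≤ k → c (j + 1) ^ 2 ≤ K * (c j * c (j + 2))) (j : ℕ) (hj : j ≤ k) :
    c j ≤ K ^ (k ^ 2) * (c 0 + c k) := by
  have hK0 : 0 ≤ K := by linarith
  have h1 := max_endpoint (fun j => c j * K ^ (j ^ 2)) (fun j => mul_nonneg (hc j) (by positivity)) k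
    (by
      intro i hi
      have e1 : (c (i + 1) * K ^ ((i + 1) ^ 2)) ^ 2 = c (i + 1) ^ 2 * K ^ (2 * (i + 1) ^ 2) := by
        ring
      have e2 : c i * K ^ (i ^ 2) * (c (i + 2) * K ^ ((i + 2) ^ 2)) =
          c i * c (i + 2) * K ^ (2 * (i + 1) ^ 2 + 2) := by
        rw [show 2 * (i + 1) ^ 2 + 2 = i ^ 2 + (i + 2) ^ 2 by ring, pow_add K]
        ring
      rw [e1, e2]
      have hcc : 0 ≤ c i * c (i + 2) := mul_nonneg (hc _) (hc _)
      calc c (i + 1) ^ 2 * K ^ (2 * (i + 1) ^ 2)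
          ≤ K * (c i * c (i + 2)) * K ^ (2 * (i + 1) ^ 2) := by
            gcongr
            exact h i hi
        _ = c i * c (i + 2) * K ^ (2 * (i + 1) ^ 2 + 1) := by ring
        _ ≤ _ := by
            gcongr
            norm_num) j hj
  have h2 : c j ≤ c j * K ^ (j ^ 2) := le_mul_of_one_le_right (hc j) (one_le_pow₀ hK)
  have h3 : c 0 * K ^ (0 ^ 2) ≤ c 0 * K ^ (k ^ 2) := by
    have := hc 0
    gcongr
    omega
  nlinarith

section final
variable {n : ℕ}

lemma opnorm_le_sum (m : ℕ) (M : ContinuousMultilinearMap ℝ (fun _ : Fin m => (EuclideanSpace ℝ (Fin n))) ℝ) :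
    ‖M‖ ≤ ∑ σ : Fin m → Fin n, ‖M (fun i => EuclideanSpace.basisFun (Fin n) ℝ (σ i))‖ := by
  apply ContinuousMultilinearMap.opNorm_le_bound (Finset.sum_nonneg fun _ _ => norm_nonneg _)
  intro v
  have hv : v = fun i => ∑ j, (v i j) • EuclideanSpace.basisFun (Fin n) ℝ j := by
    funext i
    have := (EuclideanSpace.basisFun (Fin n) ℝ).sum_repr (v i)
    simpa using this.symm
  conv_lhs => rw [hv]
  rw [ContinuousMultilinearMap.map_sum, Finset.sum_mul]
  refine (norm_sum_le _ _).trans (Finset.sum_le_sum fun σ _ => ?_)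
  rw [ContinuousMultilinearMap.map_smul_univ, norm_smul, mul_comm, norm_prod]
  gcongr with i
  exact PiLp.norm_apply_le (v i) (σ i)

lemma hasDeriv_iter (u : EuclideanSpace ℝ (Fin n) → ℝ) (hu : ContDiff ℝ (⊤ : ℕ∞) u) (j : ℕ) (e : EuclideanSpace ℝ (Fin n))
    (m : Fin j → EuclideanSpace ℝ (Fin n)) (x : EuclideanSpace ℝ (Fin n)) (t : ℝ) :
    HasDerivAt (fun s : ℝ => iteratedFDeriv ℝ j u (x + s • e) m)
      (iteratedFDeriv ℝ (j + 1) u (x + t • e) (Fin.cons e m)) t := by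
  have hd : Differentiable ℝ (iteratedFDeriv ℝ j u) :=
    hu.differentiable_iteratedFDeriv (by exact_mod_cast ENat.coe_lt_top j)
  have h1 : HasDerivAt (fun s : ℝ => x + s • e) e t := by
    simpa using ((hasDerivAt_id t).smul_const e).const_add x
  have h2 := (hd (x + t • e)).hasFDerivAt.comp_hasDerivAt t h1
  have h3 := (ContinuousMultilinearMap.apply ℝ (fun _ : Fin j => (EuclideanSpace ℝ (Fin n))) ℝ m).hasFDerivAt.comp_hasDerivAt
    t h2
  rw [iteratedFDeriv_succ_apply_left]
  simpa using! h3

lemma memLp_iter (u : EuclideanSpace ℝ (Fin n) → ℝ) (hu : ContDiff ℝ (⊤ : ℕ∞) u) (hcs : HasCompactSupport u) (j : ℕ)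
    (p : ℝ≥0∞) : MemLp (iteratedFDeriv ℝ j u) p volume :=
  (hu.continuous_iteratedFDeriv (by exact_mod_cast le_top)).memLp_of_hasCompactSupport
    (hcs.iteratedFDeriv j)

lemma vec_gn (n j : ℕ) (p q r : ℝ≥0∞) (hp : 1 ≤ p) (hq : 1 ≤ q) (hr : 1 ≤ r)
    (hpqr : 2 * (p⁻¹).toReal = (q⁻¹).toReal + (r⁻¹).toReal) :
    ∃ C : ℝ, 0 ≤ C ∧ ∀ u : EuclideanSpace ℝ (Fin n) → ℝ, ContDiff ℝ (⊤ : ℕ∞) u → HasCompactSupport u →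
      (eLpNorm (iteratedFDeriv ℝ (j + 1) u) p volume).toReal ^ 2 ≤
        C * ((eLpNorm (iteratedFDeriv ℝ j u) q volume).toReal *
          (eLpNorm (iteratedFDeriv ℝ (j + 2) u) r volume).toReal) := by
  obtain ⟨C, hC0, hC⟩ := scalar_gn (E := EuclideanSpace ℝ (Fin n)) volume p q r (zero_lt_one.trans_le hp).ne' hq hr hpqr
  refine ⟨(Fintype.card (Fin (j + 1) → Fin n)) ^ 2 * C, by positivity, fun u hu hcs => ?_⟩
  set b := EuclideanSpace.basisFun (Fin n) ℝ with hb
  have hbn : ∀ i, ‖b i‖ = 1 := fun i => b.orthonormal.1 i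
  set A := (eLpNorm (iteratedFDeriv ℝ j u) q volume).toReal
  set B := (eLpNorm (iteratedFDeriv ℝ (j + 2) u) r volume).toReal
  have hcont : ∀ (i : ℕ) (m : Fin i → EuclideanSpace ℝ (Fin n)), Continuous fun x => iteratedFDeriv ℝ i u x m := by
    intro i m
    exact (ContinuousMultilinearMap.apply ℝ (fun _ : Fin i => (EuclideanSpace ℝ (Fin n))) ℝ m).continuous.comp
      (hu.continuous_iteratedFDeriv (by exact_mod_cast le_top))
  have hbd : ∀ (i : ℕ) (m : Fin i → EuclideanSpace ℝ (Fin n)), (∀ l, ‖m l‖ = 1) → ∀ x,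
      ‖iteratedFDeriv ℝ i u x m‖ ≤ ‖iteratedFDeriv ℝ i u x‖ := by
    intro i m hm x
    refine ((iteratedFDeriv ℝ i u x).le_opNorm m).trans ?_
    simp [hm]
  have hmem : ∀ (i : ℕ) (m : Fin i → EuclideanSpace ℝ (Fin n)), (∀ l, ‖m l‖ = 1) → ∀ s : ℝ≥0∞,
      MemLp (fun x => iteratedFDeriv ℝ i u x m) s volume := fun i m hm s =>
    (memLp_iter u hu hcs i s).mono (hcont i m).aestronglyMeasurable
      (ae_of_all _ (hbd i m hm))
  have hle : ∀ (i : ℕ) (m : Fin i → EuclideanSpace ℝ (Fin n)), (∀ l, ‖m l‖ = 1) → ∀ s : ℝ≥0∞,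
      (eLpNorm (fun x => iteratedFDeriv ℝ i u x m) s volume).toReal ≤
      (eLpNorm (iteratedFDeriv ℝ i u) s volume).toReal := fun i m hm s =>
    ENNReal.toReal_mono (memLp_iter u hu hcs i s).eLpNorm_ne_top
      (eLpNorm_mono (hbd i m hm))
  have hone : ∀ σ : Fin (j + 1) → Fin n,
      (eLpNorm (fun x => iteratedFDeriv ℝ (j + 1) u x (fun i => b (σ i))) p volume).toReal ^ 2 ≤
      C * (A * B) := by
    intro σ
    have hcons : (Fin.cons (b (σ 0)) (fun i : Fin j => b (σ i.succ)) : Fin (j + 1) → EuclideanSpace ℝ (Fin n)) =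
        fun i => b (σ i) := by
      funext i
      refine Fin.cases ?_ (fun i => ?_) i <;> simp
    have hn1 : ∀ l, ‖(fun i : Fin j => b (σ i.succ)) l‖ = 1 := fun l => hbn _
    have hn2 : ∀ l, ‖(fun i : Fin (j + 1) => b (σ i)) l‖ = 1 := fun l => hbn _
    have hn3 : ∀ l, ‖(Fin.cons (b (σ 0)) (fun i : Fin (j + 1) => b (σ i)) :
        Fin (j + 2) → EuclideanSpace ℝ (Fin n)) l‖ = 1 := by
      intro l
      refine Fin.cases ?_ (fun i => ?_) l <;> simp [hbn]
    have h := hC (b (σ 0)) (fun x => iteratedFDeriv ℝ j u x (fun i => b (σ i.succ)))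
      (fun x => iteratedFDeriv ℝ (j + 1) u x (fun i => b (σ i)))
      (fun x => iteratedFDeriv ℝ (j + 2) u x (Fin.cons (b (σ 0)) (fun i => b (σ i))))
      (hcont _ _) (hcont _ _) (hcont _ _)
      (fun x t => by
        have := hasDeriv_iter u hu j (b (σ 0)) (fun i => b (σ i.succ)) x t
        rwa [hcons] at this)
      (fun x t => hasDeriv_iter u hu (j + 1) (b (σ 0)) (fun i => b (σ i)) x t)
      (hmem _ _ hn1 _) (hmem _ _ hn2 _) (hmem _ _ hn3 _)
    refine h.trans ?_
    gcongr
    · exact hle _ _ hn1 _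
    · exact hle _ _ hn3 _
  have hsum : (eLpNorm (iteratedFDeriv ℝ (j + 1) u) p volume).toReal ≤
      ∑ σ : Fin (j + 1) → Fin n,
        (eLpNorm (fun x => iteratedFDeriv ℝ (j + 1) u x (fun i => b (σ i))) p volume).toReal := by
    rw [← ENNReal.toReal_sum (fun σ _ => (hmem _ _ (fun l => hbn _) _).eLpNorm_ne_top)]
    refine ENNReal.toReal_mono (ENNReal.sum_ne_top.2
      fun σ _ => (hmem _ _ (fun l => hbn _) _).eLpNorm_ne_top) ?_
    have h1 : eLpNorm (iteratedFDeriv ℝ (j + 1) u) p volume ≤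
        eLpNorm (∑ σ : Fin (j + 1) → Fin n,
          fun x => ‖iteratedFDeriv ℝ (j + 1) u x (fun i => b (σ i))‖) p volume := by
      apply eLpNorm_mono_real
      intro x
      rw [Finset.sum_apply]
      exact opnorm_le_sum _ _
    refine h1.trans ((eLpNorm_sum_le (fun σ _ => (hcont _ _).norm.aestronglyMeasurable) hp).trans ?_)
    exact Finset.sum_le_sum fun σ _ => (eLpNorm_norm _).le
  calc _ ≤ (∑ σ : Fin (j + 1) → Fin n,
        (eLpNorm (fun x => iteratedFDeriv ℝ (j + 1) u x (fun i => b (σ i))) p volume).toReal) ^ 2 := by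
        gcongr
    _ ≤ (Fintype.card (Fin (j + 1) → Fin n)) * ∑ σ : Fin (j + 1) → Fin n,
        (eLpNorm (fun x => iteratedFDeriv ℝ (j + 1) u x (fun i => b (σ i))) p volume).toReal ^ 2 :=
        sq_sum_le_card_mul_sum_sq
    _ ≤ (Fintype.card (Fin (j + 1) → Fin n)) * ∑ σ : Fin (j + 1) → Fin n, C * (A * B) := by
        gcongr with σ
        exact hone σ
    _ = _ := by
        rw [Finset.sum_const, Finset.card_univ, nsmul_eq_mul]
        ring
end final

lemma prod_bound (n k : ℕ) (p : ℝ≥0∞) (hp : 1 ≤ p) (P : ℕ → ℝ≥0∞)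
    (hP : ∀ i ≤ k, HolderTriple (P i) (P (k - i)) p) (u v : EuclideanSpace ℝ (Fin n) → ℝ)
    (hu : ContDiff ℝ (⊤ : ℕ∞) u) (hv : ContDiff ℝ (⊤ : ℕ∞) v) :
    eLpNorm (iteratedFDeriv ℝ k (u * v)) p volume ≤ ∑ i ∈ Finset.range (k + 1),
      (k.choose i : ℝ≥0∞) * (eLpNorm (iteratedFDeriv ℝ i u) (P i) volume *
        eLpNorm (iteratedFDeriv ℝ (k - i) v) (P (k - i)) volume) := by
  have hcu : ∀ i : ℕ, Continuous (iteratedFDeriv ℝ i u) := fun i =>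
    hu.continuous_iteratedFDeriv (by exact_mod_cast le_top)
  have hcv : ∀ i : ℕ, Continuous (iteratedFDeriv ℝ i v) := fun i =>
    hv.continuous_iteratedFDeriv (by exact_mod_cast le_top)
  have h1 : eLpNorm (iteratedFDeriv ℝ k (u * v)) p volume ≤
      eLpNorm (∑ i ∈ Finset.range (k + 1), fun x => (k.choose i : ℝ) * ‖iteratedFDeriv ℝ i u x‖ *
        ‖iteratedFDeriv ℝ (k - i) v x‖) p volume := by
    apply eLpNorm_mono_real
    intro x
    rw [Finset.sum_apply]
    exact norm_iteratedFDeriv_mul_le hu hv x (by exact_mod_cast le_top)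
  refine h1.trans ((eLpNorm_sum_le (fun i _ => ?_) hp).trans (Finset.sum_le_sum fun i hi => ?_))
  · have := hcu i
    have := hcv (k - i)
    exact Continuous.aestronglyMeasurable (by fun_prop)
  · have := hP i (by simpa [Nat.lt_succ_iff] using hi)
    have h2 := eLpNorm_le_eLpNorm_mul_eLpNorm_of_nnnorm (p := P i) (q := P (k - i)) (r := p)
      (μ := (volume : Measure (EuclideanSpace ℝ (Fin n))))
      (hcu i).aestronglyMeasurable (hcv (k - i)).aestronglyMeasurable
      (fun a b => (k.choose i : ℝ) * ‖a‖ * ‖b‖) (k.choose i : ℝ≥0)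
      (ae_of_all _ fun x => by simp [nnnorm_mul])
    simpa [mul_assoc] using h2

theorem stmt_12 (n : ℕ) (hn : 1 ≤ n) (k : ℕ) (p q r : ℝ≥0∞)
    (hp : 1 ≤ p) (hq : 1 ≤ q) (hr : 1 ≤ r) (hpqr : 1 / p = 1 / q + 1 / r) :
    ∃ C : ℝ≥0, ∀ u v : EuclideanSpace ℝ (Fin n) → ℝ,
      ContDiff ℝ (⊤ : ℕ∞) u → HasCompactSupport u →
      ContDiff ℝ (⊤ : ℕ∞) v → HasCompactSupport v →
      eLpNorm (iteratedFDeriv ℝ k (u * v)) p volume ≤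
        C * (eLpNorm u q volume * eLpNorm (iteratedFDeriv ℝ k v) r volume
          + eLpNorm v q volume * eLpNorm (iteratedFDeriv ℝ k u) r volume) := by
  simp only [one_div] at hpqr
  have hzero : ∀ (w : EuclideanSpace ℝ (Fin n) → ℝ) (s : ℝ≥0∞),
      eLpNorm (iteratedFDeriv ℝ 0 w) s volume = eLpNorm w s volume := fun w s =>
    eLpNorm_congr_norm_ae (ae_of_all _ fun x => norm_iteratedFDeriv_zero)
  rcases Nat.eq_zero_or_pos k with rfl | hk
  · refine ⟨1, fun u v hu _ hv _ => ?_⟩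
    have : HolderTriple q r p := ⟨hpqr.symm⟩
    simp only [hzero]
    have h := eLpNorm_smul_le_mul_eLpNorm (p := q) (q := r) (r := p)
      (μ := (volume : Measure (EuclideanSpace ℝ (Fin n))))
      (f := v) (φ := u) hv.continuous.aestronglyMeasurable hu.continuous.aestronglyMeasurable
    rw [ENNReal.coe_one, one_mul]
    exact h.trans le_self_add
  set α := (q⁻¹).toReal with hα
  set β := (r⁻¹).toReal with hβ
  have hqi : q⁻¹ ≤ 1 := ENNReal.inv_le_one.2 hq
  have hri : r⁻¹ ≤ 1 := ENNReal.inv_le_one.2 hr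
  have hqt : q⁻¹ ≠ ∞ := (hqi.trans_lt ENNReal.one_lt_top).ne
  have hrt : r⁻¹ ≠ ∞ := (hri.trans_lt ENNReal.one_lt_top).ne
  have hα0 : 0 ≤ α := ENNReal.toReal_nonneg
  have hβ0 : 0 ≤ β := ENNReal.toReal_nonneg
  have hα1 : α ≤ 1 := 
    (ENNReal.toReal_mono ENNReal.one_ne_top hqi).trans ENNReal.toReal_one.le
  have hβ1 : β ≤ 1 := 
    (ENNReal.toReal_mono ENNReal.one_ne_top hri).trans ENNReal.toReal_one.le
  have hk0 : (0:ℝ) < k := by exact_mod_cast hk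
  set s : ℕ → ℝ := fun j => ((k - j) * α + j * β) / k with hs
  have hs0 : ∀ j ≤ k, 0 ≤ s j := by
    intro j hj
    have : (j:ℝ) ≤ k := by exact_mod_cast hj
    have : (0:ℝ) ≤ k - j := by linarith
    simp only [hs]
    positivity
  have hs1 : ∀ j ≤ k, s j ≤ 1 := by
    intro j hj
    have h1 : (j:ℝ) ≤ k := by exact_mod_cast hj
    have h2 : (0:ℝ) ≤ j := by positivity
    simp only [hs]
    rw [div_le_one hk0]
    nlinarith
  set P : ℕ → ℝ≥0∞ := fun j => (ENNReal.ofReal (s j))⁻¹ with hPdef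
  have hPi : ∀ j, (P j)⁻¹ = ENNReal.ofReal (s j) := fun j => by simp [hPdef]
  have hP1 : ∀ j ≤ k, 1 ≤ P j := by
    intro j hj
    simp only [hPdef, ENNReal.one_le_inv]
    simpa using ENNReal.ofReal_le_ofReal (hs1 j hj)
  have hPt : ∀ j ≤ k, ((P j)⁻¹).toReal = s j := fun j hj => by
    rw [hPi, ENNReal.toReal_ofReal (hs0 j hj)]
  have hP0 : P 0 = q := by
    have : s 0 = α := by simp only [hs]; field_simp; simp
    rw [← inv_inj, hPi, this, hα, ENNReal.ofReal_toReal hqt]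
  have hPk : P k = r := by
    have : s k = β := by simp only [hs]; field_simp; ring
    rw [← inv_inj, hPi, this, hβ, ENNReal.ofReal_toReal hrt]
  have hHT : ∀ i ≤ k, HolderTriple (P i) (P (k - i)) p := by
    intro i hi
    refine ⟨?_⟩
    rw [hPi, hPi, ← ENNReal.ofReal_add (hs0 _ hi) (hs0 _ (Nat.sub_le _ _)), hpqr,
      ← ENNReal.ofReal_toReal hqt, ← ENNReal.ofReal_toReal hrt, ← ENNReal.ofReal_add hα0 hβ0]
    congr 1
    simp only [hs]
    rw [Nat.cast_sub hi]
    field_simp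
    ring
  have hgn : ∀ j : ℕ, ∃ C : ℝ, 0 ≤ C ∧ (j + 2 ≤ k → ∀ u : EuclideanSpace ℝ (Fin n) → ℝ,
      ContDiff ℝ (⊤ : ℕ∞) u → HasCompactSupport u →
      (eLpNorm (iteratedFDeriv ℝ (j + 1) u) (P (j + 1)) volume).toReal ^ 2 ≤
        C * ((eLpNorm (iteratedFDeriv ℝ j u) (P j) volume).toReal *
          (eLpNorm (iteratedFDeriv ℝ (j + 2) u) (P (j + 2)) volume).toReal)) := by
    intro j
    by_cases hj : j + 2 ≤ k
    · obtain ⟨C, hC0, hC⟩ := vec_gn n j (P (j + 1)) (P j) (P (j + 2)) (hP1 _ (by omega))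
        (hP1 _ (by omega)) (hP1 _ hj) (by
          rw [hPt _ (by omega), hPt _ (by omega), hPt _ hj]
          simp only [hs]
          push_cast
          field_simp
          ring)
      exact ⟨C, hC0, fun _ => hC⟩
    · exact ⟨0, le_rfl, fun h => absurd h hj⟩
  choose Cj hCj0 hCj using hgn
  set K : ℝ := 1 + ∑ j ∈ Finset.range k, Cj j with hK
  have hsum0 : 0 ≤ ∑ j ∈ Finset.range k, Cj j := Finset.sum_nonneg fun j _ => hCj0 j
  have hK1 : 1 ≤ K := by linarith
  have hCK : ∀ j < k, Cj j ≤ K := by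
    intro j hj
    have := Finset.single_le_sum (f := Cj) (fun i _ => hCj0 i) (Finset.mem_range.2 hj)
    linarith
  have hgnK : ∀ j, j + 2 ≤ k → ∀ u : EuclideanSpace ℝ (Fin n) → ℝ,
      ContDiff ℝ (⊤ : ℕ∞) u → HasCompactSupport u →
      (eLpNorm (iteratedFDeriv ℝ (j + 1) u) (P (j + 1)) volume).toReal ^ 2 ≤
        K * ((eLpNorm (iteratedFDeriv ℝ j u) (P j) volume).toReal *
          (eLpNorm (iteratedFDeriv ℝ (j + 2) u) (P (j + 2)) volume).toReal) := by
    intro j hj u hu hcu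
    refine (hCj j hj u hu hcu).trans ?_
    gcongr
    exact hCK j (by omega)
  refine ⟨(2 ^ k * (K ^ 2) ^ (k ^ 2)).toNNReal, fun u v hu hcu hv hcv => ?_⟩
  refine (prod_bound n k p hp P hHT u v hu hv).trans ?_
  set a : ℕ → ℝ := fun j => (eLpNorm (iteratedFDeriv ℝ j u) (P j) volume).toReal with ha
  set b : ℕ → ℝ := fun j => (eLpNorm (iteratedFDeriv ℝ j v) (P j) volume).toReal with hb
  have ha0 : ∀ j, 0 ≤ a j := fun j => ENNReal.toReal_nonneg
  have hb0 : ∀ j, 0 ≤ b j := fun j => ENNReal.toReal_nonneg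
  have hae : ∀ j, eLpNorm (iteratedFDeriv ℝ j u) (P j) volume = ENNReal.ofReal (a j) := fun j =>
    (ENNReal.ofReal_toReal (memLp_iter u hu hcu j (P j)).eLpNorm_ne_top).symm
  have hbe : ∀ j, eLpNorm (iteratedFDeriv ℝ j v) (P j) volume = ENNReal.ofReal (b j) := fun j =>
    (ENNReal.ofReal_toReal (memLp_iter v hv hcv j (P j)).eLpNorm_ne_top).symm
  have hchain := chain_bound (fun j => a j * b (k - j)) (fun j => mul_nonneg (ha0 _) (hb0 _)) k
    (K ^ 2) (one_le_pow₀ hK1) (by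
      intro j hj
      obtain ⟨l, rfl⟩ : ∃ l, k = j + 2 + l := ⟨k - (j + 2), by omega⟩
      have h1 := hgnK j hj u hu hcu
      have h2 := hgnK l (by omega) v hv hcv
      change a (j + 1) ^ 2 ≤ K * (a j * a (j + 2)) at h1
      change b (l + 1) ^ 2 ≤ K * (b l * b (l + 2)) at h2
      rw [show j + 2 + l - (j + 1) = l + 1 by omega, show j + 2 + l - j = l + 2 by omega,
        show j + 2 + l - (j + 2) = l by omega]
      calc (a (j + 1) * b (l + 1)) ^ 2 = a (j + 1) ^ 2 * b (l + 1) ^ 2 := by ring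
        _ ≤ (K * (a j * a (j + 2))) * (K * (b l * b (l + 2))) := by
            apply mul_le_mul h1 h2 (sq_nonneg _)
            have := ha0 j
            have := ha0 (j + 2)
            positivity
        _ = _ := by ring)
  simp only [Nat.sub_zero, Nat.sub_self] at hchain
  have e0 : eLpNorm u q volume = ENNReal.ofReal (a 0) := by rw [← hae, hzero, hP0]
  have e1 : eLpNorm v q volume = ENNReal.ofReal (b 0) := by rw [← hbe, hzero, hP0]
  have e2 : eLpNorm (iteratedFDeriv ℝ k u) r volume = ENNReal.ofReal (a k) := by rw [← hae, hPk]
  have e3 : eLpNorm (iteratedFDeriv ℝ k v) r volume = ENNReal.ofReal (b k) := by rw [← hbe, hPk]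
  rw [e0, e1, e2, e3]
  simp only [hae, hbe]
  have hak := ha0 k
  have hbk := hb0 k
  have ha00 := ha0 0
  have hb00 := hb0 0
  have hK0 : 0 ≤ K := by linarith
  calc ∑ i ∈ Finset.range (k + 1), (k.choose i : ℝ≥0∞) *
        (ENNReal.ofReal (a i) * ENNReal.ofReal (b (k - i)))
      ≤ ∑ i ∈ Finset.range (k + 1), (k.choose i : ℝ≥0∞) *
        ENNReal.ofReal ((K ^ 2) ^ (k ^ 2) * (a 0 * b k + a k * b 0)) := by
        refine Finset.sum_le_sum fun i hi => ?_
        rw [← ENNReal.ofReal_mul (ha0 i)]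
        refine mul_le_mul_right (ENNReal.ofReal_le_ofReal ?_) _
        exact hchain i (by simpa [Nat.lt_succ_iff] using hi)
    _ = 2 ^ k * ENNReal.ofReal ((K ^ 2) ^ (k ^ 2) * (a 0 * b k + a k * b 0)) := by
        rw [← Finset.sum_mul]
        congr 1
        exact_mod_cast Nat.sum_range_choose k
    _ = _ := by
        rw [← ENNReal.ofReal_mul ha00, ← ENNReal.ofReal_mul hb00,
          ← ENNReal.ofReal_add (by positivity) (by positivity), ← ENNReal.ofReal,
          ← ENNReal.ofReal_mul (by positivity), ← ENNReal.ofReal_ofNat 2,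
          ← ENNReal.ofReal_pow (by norm_num), ← ENNReal.ofReal_mul (by positivity)]
        congr 1
        ring
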